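/- arXiv:2303.02656 — 3 statements merged into one kernel-verified Lean document; each statement's English description precedes it below -/
import Mathlib

section
/- Let X be a Tychonoff space satisfying U_fin(Γ_F, Γ). Then X satisfies U_fin(O^ω_cz, Γ): given any sequence of countable cozero covers U_n = {U^n_m : m ∈ ℕ} of X, defining W^n_k = ⋃{f_{n,m}^{-1}((1/(i+2),1]) : i,m ≤ k} (where f_{n,m} : X → [0,1] is continuous with f_{n,m}^{-1}((0,1]) = U^n_m), the covers W_n = {W^n_k : k ∈ ℕ} are γ_F-shrinkable γ-covers refining U_n, and a U_fin selection from (W_n) yields a U_fin(O^ω_cz, Γ) selection from (U_n). -/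
open Set Filter Topology

/-- A family is a γ-cover: it is infinite and every point belongs to all but
finitely many members. -/
def IsGammaCover {X : Type*} (𝒰 : Set (Set X)) : Prop :=
  𝒰.Infinite ∧ ∀ x : X, {V ∈ 𝒰 | x ∉ V}.Finite

/-- The Hurewicz property `U_fin(𝒪, Γ)`. -/
def Hurewicz (Y : Type*) [TopologicalSpace Y] : Prop :=
  ∀ 𝒰 : ℕ → Set (Set Y),
    (∀ n, (∀ V ∈ 𝒰 n, IsOpen V) ∧ ⋃₀ 𝒰 n = Set.univ) →
    ∃ 𝒱 : ℕ → Set (Set Y), (∀ n, 𝒱 n ⊆ 𝒰 n ∧ (𝒱 n).Finite) ∧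
      ∀ y : Y, ∀ᶠ n in Filter.atTop, y ∈ ⋃₀ 𝒱 n

/-- A space is projectively Hurewicz if every separable metrizable continuous
image of it is Hurewicz. -/
def ProjHurewicz (X : Type*) [TopologicalSpace X] : Prop :=
  ∀ (Y : Type) [TopologicalSpace Y],
    TopologicalSpace.MetrizableSpace Y → TopologicalSpace.SeparableSpace Y →
    ∀ f : X → Y, Continuous f → Function.Surjective f → Hurewicz Y

/-- A zero-set: the preimage of `{0}` of a continuous real-valued function. -/
def IsZeroSet {X : Type*} [TopologicalSpace X] (F : Set X) : Prop :=
  ∃ f : X → ℝ, Continuous f ∧ F = f ⁻¹' {0}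

/-- A cozero set: the complement of a zero-set. -/
def IsCozero {X : Type*} [TopologicalSpace X] (U : Set X) : Prop :=
  ∃ f : X → ℝ, Continuous f ∧ U = f ⁻¹' {0}ᶜ

/-- A (countable) cozero γ-cover which is γ_F-shrinkable: it admits a
γ-cover by zero-sets shrinking it. -/
def GammaFShrinkable {X : Type*} [TopologicalSpace X] (𝒰 : Set (Set X)) : Prop :=
  𝒰.Countable ∧ (∀ V ∈ 𝒰, IsCozero V) ∧ IsGammaCover 𝒰 ∧
    ∃ F : Set X → Set X, (∀ V ∈ 𝒰, IsZeroSet (F V) ∧ F V ⊆ V) ∧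
      (F '' 𝒰).Infinite ∧ ∀ x : X, {V ∈ 𝒰 | x ∉ F V}.Finite

/-- An ω-groupable open cover: an open cover admitting a partition into finite
parts such that every finite set is contained in a member of all but finitely
many parts. -/
def OmegaGroupable {X : Type*} [TopologicalSpace X] (𝒲 : Set (Set X)) : Prop :=
  (∀ V ∈ 𝒲, IsOpen V) ∧ ⋃₀ 𝒲 = Set.univ ∧
    ∃ P : ℕ → Set (Set X), (∀ n, (P n).Finite ∧ (P n).Nonempty) ∧
      (⋃ n, P n) = 𝒲 ∧ (∀ m n, m ≠ n → Disjoint (P m) (P n)) ∧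
      ∀ F : Set X, F.Finite → ∀ᶠ n in Filter.atTop, ∃ U ∈ P n, F ⊆ U

/-- `C_p(X)`: continuous real-valued functions with the topology of pointwise
convergence (subspace of the product `X → ℝ`). -/
abbrev Cp (X : Type*) [TopologicalSpace X] : Type _ :=
  {f : X → ℝ // Continuous f}

/-- The constant zero function in `C_p(X)`. -/
def zeroCp (X : Type*) [TopologicalSpace X] : Cp X :=
  ⟨fun _ => 0, continuous_const⟩

/-- `A ∈ Γ_g`: `A` is infinite, `g ∉ A` and `A` converges to `g`. -/
def GammaAt {X : Type*} [TopologicalSpace X] (g : Cp X) (A : Set (Cp X)) : Prop :=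
  A.Infinite ∧ g ∉ A ∧ ∀ W ∈ 𝓝 g, (A \ W).Finite

/-- `B ∈ wΓ_g`: `B` admits a partition into finite parts weakly converging
to `g`. -/
def WGammaAt {X : Type*} [TopologicalSpace X] (g : Cp X) (B : Set (Cp X)) : Prop :=
  ∃ S : ℕ → Set (Cp X), (∀ n, (S n).Finite ∧ (S n).Nonempty) ∧
    (⋃ n, S n) = B ∧ (∀ m n, m ≠ n → Disjoint (S m) (S n)) ∧
    ∀ W ∈ 𝓝 g, ∃ s : ℕ → Cp X, (∀ n, s n ∈ S n) ∧ ∀ᶠ n in Filter.atTop, s n ∈ W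

/-- The selection principle `S_fin(Γ_g, wΓ_g)` for `C_p(X)` at the point `g`. -/
def SfinGammaWGamma {X : Type*} [TopologicalSpace X] (g : Cp X) : Prop :=
  ∀ A : ℕ → Set (Cp X), (∀ n, GammaAt g (A n)) →
    ∃ B : ℕ → Set (Cp X), (∀ n, B n ⊆ A n ∧ (B n).Finite) ∧ WGammaAt g (⋃ n, B n)

/-- The selection principle `S_fin(Γ_F, Ω^gr)` for a space `X`. -/
def SfinGammaFOmegaGr (X : Type*) [TopologicalSpace X] : Prop :=
  ∀ 𝒰 : ℕ → Set (Set X), (∀ n, GammaFShrinkable (𝒰 n)) →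
    ∃ 𝒱 : ℕ → Set (Set X), (∀ n, 𝒱 n ⊆ 𝒰 n ∧ (𝒱 n).Finite) ∧
      OmegaGroupable (⋃ n, 𝒱 n)

lemma isZeroSet_le {X : Type*} [TopologicalSpace X] {f : X → ℝ} (hf : Continuous f) (c : ℝ) :
    IsZeroSet {x | c ≤ f x} := by
  refine ⟨fun x => max 0 (c - f x), by fun_prop, ?_⟩
  ext x
  simp

lemma isCozero_lt {X : Type*} [TopologicalSpace X] {f : X → ℝ} (hf : Continuous f) (c : ℝ) :
    IsCozero {x | c < f x} := by
  refine ⟨fun x => max 0 (f x - c), by fun_prop, ?_⟩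
  ext x
  simp

lemma monotone_setOf_inv_lt {X : Type*} {p : ℕ → X → ℝ} (hp : Monotone p) :
    Monotone fun k : ℕ => {x | 1 / ((k : ℝ) + 1) < p k x} := by
  intro k l hkl x hx
  exact (Nat.one_div_le_one_div hkl).trans_lt (lt_of_lt_of_le hx (hp hkl x))

lemma Monotone.exists_sUnion_subset {X : Type*} {W : ℕ → Set X} (hW : Monotone W)
    {𝒢 : Set (Set X)} (hsub : 𝒢 ⊆ range W) (hfin : 𝒢.Finite) : ∃ k, ⋃₀ 𝒢 ⊆ W k := by
  choose! i hi using hsub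
  obtain ⟨k, hk⟩ := (hfin.image i).bddAbove
  refine ⟨k, sUnion_subset fun V hV => ?_⟩
  rw [← hi hV]
  exact hW (hk (mem_image_of_mem i hV))

lemma Monotone.not_exists_finite_subcover {X : Type*} {W : ℕ → Set X} (hW : Monotone W)
    (hne : ∀ k, W k ≠ univ) : ¬ ∃ 𝒢 ⊆ range W, 𝒢.Finite ∧ ⋃₀ 𝒢 = univ := by
  rintro ⟨𝒢, hsub, hfin, hcov⟩
  obtain ⟨k, hk⟩ := hW.exists_sUnion_subset hsub hfin
  exact hne k (univ_subset_iff.1 (hcov ▸ hk))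

/-- The superlevel sets of an increasing sequence of continuous functions at levels tending to
zero form a shrinkable γ-cover, when none of them is the whole space. -/
lemma gammaFShrinkable_range {X : Type*} [TopologicalSpace X] {p : ℕ → X → ℝ}
    (hc : ∀ k, Continuous (p k)) (hp : Monotone p) (hpos : ∀ x, ∃ k, 0 < p k x)
    (hne : ∀ k : ℕ, {x | 1 / ((k : ℝ) + 1) < p k x} ≠ univ) :
    GammaFShrinkable (range fun k : ℕ => {x | 1 / ((k : ℝ) + 1) < p k x}) := by
  set W : ℕ → Set X := fun k => {x | 1 / ((k : ℝ) + 1) < p k x}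
  have hW : Monotone W := monotone_setOf_inv_lt hp
  have hFW : ∀ k : ℕ, {x | 2 / ((k : ℝ) + 1) ≤ p k x} ⊆ W k := by
    intro k x hx
    refine lt_of_lt_of_le ?_ (mem_ofPred.1 hx)
    gcongr
    norm_num
  have hev : ∀ x, ∀ᶠ k : ℕ in atTop, 2 / ((k : ℝ) + 1) ≤ p k x := by
    intro x
    obtain ⟨m, hm⟩ := hpos x
    have ht : Tendsto (fun k : ℕ => 2 / ((k : ℝ) + 1)) atTop (𝓝 0) := by
      simpa [div_eq_mul_inv] using (tendsto_one_div_add_atTop_nhds_zero_nat (𝕜 := ℝ)).const_mul 2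
    filter_upwards [ht.eventually_lt_const hm, eventually_ge_atTop m] with k hk hmk
    exact hk.le.trans (hp hmk x)
  have hex : ∀ V ∈ range W, ∃ k, W k = V := fun V hV => hV
  choose! i hi using hex
  have hfin : ∀ x, {V ∈ range W | x ∉ {y | 2 / ((i V : ℝ) + 1) ≤ p (i V) y}}.Finite := by
    intro x
    obtain ⟨N, hN⟩ := eventually_atTop.1 (hev x)
    refine ((finite_lt_nat N).image W).subset ?_
    rintro V ⟨hV, hx⟩
    refine ⟨i V, ?_, hi V hV⟩
    by_contra hlt
    exact hx (hN _ (not_lt.1 hlt))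
  have hsub : ∀ V ∈ range W, {y | 2 / ((i V : ℝ) + 1) ≤ p (i V) y} ⊆ V := by
    intro V hV
    exact (hFW (i V)).trans (hi V hV).le
  have hinf : (range W).Infinite := by
    intro hf
    refine hW.not_exists_finite_subcover hne ⟨range W, Subset.rfl, hf, ?_⟩
    refine eq_univ_of_forall fun x => ?_
    obtain ⟨k, hk⟩ := (hev x).exists
    exact ⟨W k, mem_range_self k, hFW k hk⟩
  refine ⟨countable_range W, ?_, ⟨hinf, fun x => ?_⟩,
    fun V => {y | 2 / ((i V : ℝ) + 1) ≤ p (i V) y},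
    fun V hV => ⟨isZeroSet_le (hc _) _, hsub V hV⟩, ?_, hfin⟩
  · rintro _ ⟨k, rfl⟩
    exact isCozero_lt (hc k) _
  · exact (hfin x).subset fun V hV => ⟨hV.1, fun hx => hV.2 (hsub V hV.1 hx)⟩
  · intro hf
    refine hinf (hf.of_finite_fibers _ ?_)
    rintro _ ⟨V, hV, rfl⟩
    obtain ⟨x, hx⟩ := (ne_univ_iff_exists_notMem V).1 (by
      obtain ⟨k, rfl⟩ := hV
      exact hne k)
    refine (hfin x).subset ?_
    rintro V' ⟨hV', heq⟩
    refine ⟨hV', fun hx' => hx (hsub V hV ?_)⟩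
    exact heq.le hx'

/-- An indexed sequence of proper subsets that eventually contains each point is a γ-cover. -/
lemma isGammaCover_range {X : Type*} {V : ℕ → Set X} (hne : ∀ n, V n ≠ univ)
    (hev : ∀ x, ∀ᶠ n in atTop, x ∈ V n) : IsGammaCover (range V) := by
  refine ⟨fun hf => ?_, fun x => ?_⟩
  · choose z hz using fun n => (ne_univ_iff_exists_notMem (V n)).1 (hne n)
    have hall : ∀ᶠ n in atTop, ∀ A ∈ range V, A ≠ univ → ¬ V n = A := by
      refine (hf.eventually_all).2 ?_
      rintro A ⟨m, rfl⟩
      filter_upwards [hev (z m)] with n hn _ heq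
      exact hz m (heq ▸ hn)
    obtain ⟨n, hn⟩ := hall.exists
    exact hn (V n) (mem_range_self n) (hne n) rfl
  · obtain ⟨N, hN⟩ := eventually_atTop.1 (hev x)
    refine ((finite_lt_nat N).image V).subset ?_
    rintro _ ⟨⟨n, rfl⟩, hx⟩
    refine ⟨n, ?_, rfl⟩
    by_contra hlt
    exact hx (hN n (not_lt.1 hlt))

/-- A γ-cover presented as the range of a sequence has a subsequence that eventually contains
each point. -/
lemma IsGammaCover.exists_strictMono_eventually_mem {X : Type*} {V : ℕ → Set X}
    (hV : IsGammaCover (range V)) :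
    ∃ φ : ℕ → ℕ, StrictMono φ ∧ ∀ x, ∀ᶠ n in atTop, x ∈ V (φ n) := by
  have := hV.1.to_subtype
  let e := hV.1.natEmbedding
  choose ψ hψ using fun n => (e n).2
  have hψinj : Function.Injective (V ∘ ψ) := by
    intro a b hab
    apply e.injective
    apply Subtype.ext
    rw [← hψ a, ← hψ b]
    exact hab
  obtain ⟨χ, hχ, hψχ⟩ := strictMono_subseq_of_tendsto_atTop hψinj.of_comp.nat_tendsto_atTop
  refine ⟨ψ ∘ χ, hψχ, fun x => ?_⟩
  have hfin : {n | x ∉ V (ψ (χ n))}.Finite := by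
    refine Finite.of_finite_image (f := fun n => V (ψ (χ n))) ((hV.2 x).subset ?_)
      (hψinj.comp hχ.injective).injOn
    rintro _ ⟨n, hn, rfl⟩
    exact ⟨mem_range_self _, hn⟩
  rw [← Nat.cofinite_eq_atTop]
  exact hfin.eventually_cofinite_notMem.mono fun n hn => not_not.1 hn

/-- If `X` satisfies `U_fin(Γ_F, Γ)` then `X` satisfies
`U_fin(𝒪^ω_cz, Γ)`. -/
theorem Ufin_GammaF_implies_Ufin_cozero (X : Type*) [TopologicalSpace X] [T35Space X]
    (h : ∀ 𝒰 : ℕ → Set (Set X),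
      (∀ n, GammaFShrinkable (𝒰 n) ∧ ¬ ∃ 𝒢 ⊆ 𝒰 n, 𝒢.Finite ∧ ⋃₀ 𝒢 = Set.univ) →
      ∃ ℱ : ℕ → Set (Set X), (∀ n, ℱ n ⊆ 𝒰 n ∧ (ℱ n).Finite) ∧
        IsGammaCover (Set.range fun n => ⋃₀ ℱ n)) :
    ∀ 𝒰 : ℕ → Set (Set X),
      (∀ n, (𝒰 n).Countable ∧ (∀ V ∈ 𝒰 n, IsCozero V) ∧ ⋃₀ 𝒰 n = Set.univ ∧
        ¬ ∃ 𝒢 ⊆ 𝒰 n, 𝒢.Finite ∧ ⋃₀ 𝒢 = Set.univ) →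
      ∃ ℱ : ℕ → Set (Set X), (∀ n, ℱ n ⊆ 𝒰 n ∧ (ℱ n).Finite) ∧
        IsGammaCover (Set.range fun n => ⋃₀ ℱ n) := by
  intro 𝒰 h𝒰
  choose hcount hcoz hcover hnot using h𝒰
  have hnonempty : ∀ n, (𝒰 n).Nonempty := by
    intro n
    refine nonempty_iff_ne_empty.2 fun hempty => hnot n ⟨∅, empty_subset _, finite_empty, ?_⟩
    rw [← hempty, hcover n]
  choose U hU using fun n => (hcount n).exists_eq_range (hnonempty n)
  have hUmem : ∀ n m, U n m ∈ 𝒰 n := fun n m => (hU n).ge (mem_range_self m)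
  choose f hfc hf using fun n m => hcoz n (U n m) (hUmem n m)
  let q : ℕ → ℕ → X → ℝ := fun n k x => ∑ m ∈ Finset.range (k + 1), |f n m x|
  let p : ℕ → ℕ → X → ℝ := fun n k x =>
    (Finset.range (n + 1)).inf' Finset.nonempty_range_add_one fun j => q j k x
  have hqmono : ∀ n, Monotone (q n) := fun n k l hkl x =>
    Finset.sum_le_sum_of_subset_of_nonneg (Finset.range_mono (by omega)) fun _ _ _ => abs_nonneg _
  have hple : ∀ {j n : ℕ}, j ≤ n → ∀ k x, p n k x ≤ q j k x := fun hjn k x =>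
    Finset.inf'_le _ (Finset.mem_range.2 (by omega))
  have hpmono : ∀ n, Monotone (p n) := fun n k l hkl x =>
    Finset.le_inf' _ _ fun j hj =>
      (hple (Finset.mem_range_succ_iff.1 hj) k x).trans (hqmono j hkl x)
  have hpc : ∀ n k, Continuous (p n k) := by
    intro n k
    refine Continuous.finset_inf'_apply _ fun j _ => ?_
    exact continuous_finsetSum _ fun m _ => (hfc j m).abs
  have hqpos : ∀ n x, ∃ k, 0 < q n k x := by
    intro n x
    obtain ⟨V, hV, hx⟩ := mem_sUnion.1 ((hcover n).ge (mem_univ x))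
    rw [hU n] at hV
    obtain ⟨m, rfl⟩ := hV
    rw [hf n m] at hx
    refine ⟨m, (abs_pos.2 hx).trans_le ?_⟩
    exact Finset.single_le_sum (f := fun m => |f n m x|) (fun _ _ => abs_nonneg _)
      (Finset.self_mem_range_succ m)
  have hppos : ∀ n x, ∃ k, 0 < p n k x := by
    intro n x
    choose k hk using fun j => hqpos j x
    refine ⟨(Finset.range (n + 1)).sup k, (Finset.lt_inf'_iff _).2 fun j hj => ?_⟩
    exact (hk j).trans_le (hqmono j (Finset.le_sup hj) x)
  let G : ℕ → ℕ → Set (Set X) := fun n k => U n '' (Finset.range (k + 1) : Set ℕ)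
  have hGsub : ∀ n k, G n k ⊆ 𝒰 n := by
    rintro n k _ ⟨m, -, rfl⟩
    exact hUmem n m
  have hGfin : ∀ n k, (G n k).Finite := fun n k => (Finset.finite_toSet _).image _
  have hGne : ∀ n k, ⋃₀ G n k ≠ univ := fun n k heq =>
    hnot n ⟨G n k, hGsub n k, hGfin n k, heq⟩
  let W : ℕ → ℕ → Set X := fun n k => {x | 1 / ((k : ℝ) + 1) < p n k x}
  have hWG : ∀ {j n : ℕ}, j ≤ n → ∀ k, W n k ⊆ ⋃₀ G j k := by
    intro j n hjn k x hx
    have hq : 0 < q j k x := (Nat.one_div_pos_of_nat.trans hx).trans_le (hple hjn k x)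
    obtain ⟨m, hm, hne⟩ := Finset.exists_ne_zero_of_sum_ne_zero hq.ne'
    refine ⟨U j m, mem_image_of_mem _ hm, ?_⟩
    rw [hf j m]
    exact abs_ne_zero.1 hne
  have hWne : ∀ n k, W n k ≠ univ := fun n k heq =>
    hGne n k (univ_subset_iff.1 (heq ▸ hWG le_rfl k))
  have hWmono : ∀ n, Monotone (W n) := fun n => monotone_setOf_inv_lt (hpmono n)
  obtain ⟨ℱ, hℱ, hγ⟩ := h (fun n => range (W n)) fun n =>
    ⟨gammaFShrinkable_range (hpc n) (hpmono n) (hppos n) (hWne n),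
      (hWmono n).not_exists_finite_subcover (hWne n)⟩
  obtain ⟨φ, hφ, hev⟩ := hγ.exists_strictMono_eventually_mem
  choose k hk using fun n => (hWmono n).exists_sUnion_subset (hℱ n).1 (hℱ n).2
  refine ⟨fun n => G n (k (φ n)), fun n => ⟨hGsub _ _, hGfin _ _⟩,
    isGammaCover_range (fun n => hGne _ _) fun x => ?_⟩
  filter_upwards [hev x] with n hn
  exact hWG (hφ.id_le n) _ (hk _ hn)
end

section
/- For separable metrizable spaces, the Hurewicz property U_fin(O, Γ) is equivalent to the selection principle S_fin(Γ, Ω^gr): for every sequence (U_n) of open γ-covers there are finite V_n ⊆ U_n such that ⋃_n V_n is an ω-groupable cover. -/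
open Set Filter Topology

/-- For a Hurewicz space, countably many sequences of open sets converging to the whole space
can be cut into finite windows, starting at any position, which eventually capture each point. -/
lemma Hurewicz.exists_window {X : Type*} [TopologicalSpace X] (hX : Hurewicz X)
    (W : ℕ → ℕ → Set X) (hWo : ∀ n l, IsOpen (W n l))
    (hW : ∀ n x, ∀ᶠ l in atTop, x ∈ W n l) :
    ∃ L : ℕ → ℕ → ℕ, ∀ x, ∀ᶠ n in atTop, ∀ l, ∃ k, l ≤ k ∧ k < L n l ∧ x ∈ W n k := by
  obtain ⟨𝒱, h𝒱, hcov⟩ := hX (fun p => W p.unpair.1 '' Ici p.unpair.2) (by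
    refine fun p => ⟨?_, ?_⟩
    · rintro _ ⟨k, -, rfl⟩
      exact hWo _ _
    · refine eq_univ_of_forall fun x => ?_
      obtain ⟨k, hk, hxk⟩ := ((eventually_ge_atTop p.unpair.2).and (hW p.unpair.1 x)).exists
      exact ⟨_, ⟨k, hk, rfl⟩, hxk⟩)
  have hbound : ∀ p, ∃ N, ∀ V ∈ 𝒱 p, ∃ k, p.unpair.2 ≤ k ∧ k < N ∧ W p.unpair.1 k = V := by
    intro p
    obtain ⟨T, hTsub, hT, hTV⟩ :=
      Set.exists_subset_image_finite_and.1 ⟨𝒱 p, (h𝒱 p).1, (h𝒱 p).2, rfl⟩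
    obtain ⟨N, hN⟩ := hT.bddAbove
    refine ⟨N + 1, fun V hV => ?_⟩
    rw [hTV] at hV
    obtain ⟨k, hk, rfl⟩ := hV
    exact ⟨k, hTsub hk, Nat.lt_succ_of_le (hN hk), rfl⟩
  choose N hN using hbound
  refine ⟨fun n l => N (Nat.pair n l), fun x => ?_⟩
  obtain ⟨n₀, hn₀⟩ := eventually_atTop.1 (hcov x)
  filter_upwards [eventually_ge_atTop n₀] with n hn l
  obtain ⟨V, hV, hxV⟩ := hn₀ (Nat.pair n l) (hn.trans (Nat.left_le_pair n l))
  obtain ⟨k, hk, hkN, rfl⟩ := hN _ V hV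
  simp only [Nat.unpair_pair] at hk hxV
  exact ⟨k, hk, hkN, hxV⟩

/-- The windows of `Hurewicz.exists_window` can be chosen so that one member of the window
contains all the points of a given set of `m` points. -/
lemma Hurewicz.exists_window_finset {X : Type*} [TopologicalSpace X] (hX : Hurewicz X)
    (W : ℕ → ℕ → Set X) (hWo : ∀ n l, IsOpen (W n l))
    (hW : ∀ n x, ∀ᶠ l in atTop, x ∈ W n l) (m : ℕ) :
    ∃ g : ℕ → ℕ → ℕ, ∀ F : Finset X, F.card = m →
      ∀ᶠ n in atTop, ∀ l, ∃ k, l ≤ k ∧ k < g n l ∧ ↑F ⊆ W n k := by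
  induction m with
  | zero =>
    refine ⟨fun _ l => l + 1, fun F hF => Eventually.of_forall fun n l => ⟨l, le_rfl, by simp, ?_⟩⟩
    simp [Finset.card_eq_zero.1 hF]
  | succ m ih =>
    classical
    obtain ⟨g, hg⟩ := ih
    obtain ⟨L, hL⟩ := hX.exists_window (fun n l => ⋂ k ∈ Finset.Ico l (g n l), W n k)
      (fun n l => isOpen_biInter_finset fun k _ => hWo n k) (fun n x => by
        obtain ⟨k₀, hk₀⟩ := eventually_atTop.1 (hW n x)
        filter_upwards [eventually_ge_atTop k₀] with l hl
        refine mem_iInter₂.2 fun k hk => hk₀ k (hl.trans (Finset.mem_Ico.1 hk).1))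
    refine ⟨fun n l => (Finset.range (L n l)).sup (g n), fun F hF => ?_⟩
    obtain ⟨x, F', -, rfl, hF'⟩ := Finset.card_eq_succ.1 hF
    filter_upwards [hL x, hg F' hF'] with n hxn hFn l
    obtain ⟨i, hli, hiL, hxi⟩ := hxn l
    obtain ⟨k, hik, hkg, hFk⟩ := hFn i
    refine ⟨k, hli.trans hik,
      hkg.trans_le (Finset.le_sup (f := g n) (Finset.mem_range.2 hiL)), ?_⟩
    rw [Finset.coe_insert, insert_subset_iff]
    exact ⟨mem_iInter₂.1 hxi k (Finset.mem_Ico.2 ⟨hik, hkg⟩), hFk⟩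

lemma Hurewicz.exists_omegaGroupable {X : Type*} [TopologicalSpace X] (hX : Hurewicz X)
    (𝒰 : ℕ → Set (Set X)) (h𝒰 : ∀ n, (∀ V ∈ 𝒰 n, IsOpen V) ∧ IsGammaCover (𝒰 n)) :
    ∃ 𝒱 : ℕ → Set (Set X), (∀ n, 𝒱 n ⊆ 𝒰 n ∧ (𝒱 n).Finite) ∧
      OmegaGroupable (⋃ n, 𝒱 n) := by
  have henum : ∀ n, ∃ u : ℕ → Set X, Function.Injective u ∧ ∀ k, u k ∈ 𝒰 n := fun n =>
    ⟨fun k => (h𝒰 n).2.1.natEmbedding (𝒰 n) k,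
      Subtype.val_injective.comp ((h𝒰 n).2.1.natEmbedding (𝒰 n)).injective,
      fun k => Subtype.coe_prop _⟩
  choose u hu_inj hu using henum
  have hu_ev : ∀ n x, ∀ᶠ k in atTop, x ∈ u n k := by
    intro n x
    have hfin : {k | x ∉ u n k}.Finite :=
      (((h𝒰 n).2.2 x).preimage (hu_inj n).injOn).subset fun k hk => ⟨hu n k, hk⟩
    rw [← Nat.cofinite_eq_atTop]
    exact hfin
  choose g hg using hX.exists_window_finset u (fun n k => (h𝒰 n).1 _ (hu n k)) hu_ev
  let G : ℕ → ℕ → ℕ := fun n l => max (l + 1) ((Finset.range (n + 1)).sup fun m => g m n l)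
  have hG : ∀ F : Finset X, ∀ᶠ n in atTop, ∀ l, ∃ k, l ≤ k ∧ k < G n l ∧ ↑F ⊆ u n k := by
    intro F
    filter_upwards [hg F.card F rfl, eventually_ge_atTop F.card] with n hn hFn l
    obtain ⟨k, hlk, hkg, hFk⟩ := hn l
    refine ⟨k, hlk, hkg.trans_le (le_max_of_le_right ?_), hFk⟩
    exact Finset.le_sup (f := fun m => g m n l) (Finset.mem_range.2 (Nat.lt_succ_of_le hFn))
  have hstart : ∀ n (T : Set (Set X)), T.Finite → ∃ l, ∀ k, l ≤ k → u n k ∉ T := by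
    intro n T hT
    obtain ⟨N, hN⟩ := (hT.preimage (hu_inj n).injOn).bddAbove
    exact ⟨N + 1, fun k hk hkT => by have := hN hkT; omega⟩
  choose! start hstart using hstart
  let step : ℕ → Set (Set X) → Set (Set X) := fun n T => u n '' Ico (start n T) (G n (start n T))
  let A : ℕ → Set (Set X) := fun n => Nat.rec ∅ (fun n T => T ∪ step n T) n
  have hA_succ : ∀ n, A (n + 1) = A n ∪ step n (A n) := fun n => rfl
  have hA_fin : ∀ n, (A n).Finite := by
    intro n
    induction n with
    | zero => exact finite_empty
    | succ n ih => exact ih.union ((finite_Ico _ _).image _)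
  have hA_mono : Monotone A := monotone_nat_of_le_succ fun n => by
    rw [hA_succ]; exact subset_union_left
  have hdisj : ∀ m n, m < n → Disjoint (step m (A m)) (step n (A n)) := by
    intro m n hmn
    refine disjoint_left.2 ?_
    rintro _ hm ⟨k, hk, rfl⟩
    refine hstart n (A n) (hA_fin n) k hk.1 (hA_mono (Nat.succ_le_of_lt hmn) ?_)
    exact (hA_succ m).symm ▸ Or.inr hm
  have hcapture : ∀ F : Finset X, ∀ᶠ n in atTop, ∃ U ∈ step n (A n), ↑F ⊆ U := by
    intro F
    filter_upwards [hG F] with n hn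
    obtain ⟨k, hlk, hkG, hFk⟩ := hn (start n (A n))
    exact ⟨u n k, ⟨k, ⟨hlk, hkG⟩, rfl⟩, hFk⟩
  have hsub : ∀ n, step n (A n) ⊆ 𝒰 n := by
    rintro n _ ⟨k, -, rfl⟩
    exact hu n k
  have hfin : ∀ n, (step n (A n)).Finite := fun n => (finite_Ico _ _).image _
  refine ⟨fun n => step n (A n), fun n => ⟨hsub n, hfin n⟩, ?_, ?_,
    fun n => step n (A n), fun n => ⟨hfin n, ?_⟩, rfl, ?_, ?_⟩
  · intro V hV
    obtain ⟨n, hn⟩ := mem_iUnion.1 hV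
    exact (h𝒰 n).1 V (hsub n hn)
  · refine eq_univ_of_forall fun x => ?_
    obtain ⟨n, U, hU, hxU⟩ := (hcapture {x}).exists
    exact ⟨U, mem_iUnion.2 ⟨n, hU⟩, hxU (by simp)⟩
  · exact ⟨_, start n (A n), ⟨le_rfl, lt_max_of_lt_left (Nat.lt_succ_self _)⟩, rfl⟩
  · intro m n hmn
    rcases hmn.lt_or_gt with h | h
    · exact hdisj m n h
    · exact (hdisj n m h).symm
  · intro F hF
    simpa using hcapture hF.toFinset

/-- An increasing sequence of proper subsets exhausting the space is a γ-cover. -/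
lemma isGammaCover_range_s11 {X : Type*} {W : ℕ → Set X} (hmono : Monotone W)
    (hcov : ∀ x, ∃ k, x ∈ W k) (hne : ∀ k, W k ≠ univ) : IsGammaCover (range W) := by
  refine ⟨fun hfin => ?_, fun x => ?_⟩
  · obtain ⟨T, -, hT, hTW⟩ := Set.exists_subset_image_finite_and (f := W) (s := univ).1
      ⟨range W, by simp, hfin, rfl⟩
    obtain ⟨K, hK⟩ := hT.bddAbove
    refine hne K (eq_univ_of_forall fun x => ?_)
    obtain ⟨k, hk⟩ := hcov x
    have hkT : W k ∈ W '' T := hTW.subset (mem_range_self k)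
    obtain ⟨i, hi, hik⟩ := hkT
    exact hmono (hK hi) (hik ▸ hk)
  · obtain ⟨k, hk⟩ := hcov x
    refine ((finite_Iio k).image W).subset ?_
    rintro _ ⟨⟨i, rfl⟩, hi⟩
    exact ⟨i, lt_of_not_ge fun hki => hi (hmono hki hk), rfl⟩

lemma hurewicz_of_forall_exists_omegaGroupable {X : Type*} [TopologicalSpace X]
    [SecondCountableTopology X]
    (h : ∀ 𝒰 : ℕ → Set (Set X), (∀ n, (∀ V ∈ 𝒰 n, IsOpen V) ∧ IsGammaCover (𝒰 n)) →
      ∃ 𝒱 : ℕ → Set (Set X), (∀ n, 𝒱 n ⊆ 𝒰 n ∧ (𝒱 n).Finite) ∧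
        OmegaGroupable (⋃ n, 𝒱 n)) : Hurewicz X := by
  intro 𝒰 h𝒰
  by_cases hsubcover : ∀ n, ∃ T ⊆ 𝒰 n, T.Finite ∧ ⋃₀ T = univ
  · choose T hTsub hTfin hT using hsubcover
    exact ⟨T, fun n => ⟨hTsub n, hTfin n⟩, fun y => Eventually.of_forall fun n => by simp [hT n]⟩
  push Not at hsubcover
  obtain ⟨n₀, hn₀⟩ := hsubcover
  have hXne : (univ : Set X).Nonempty :=
    nonempty_iff_ne_empty.2 fun hemp =>
      hn₀ ∅ (empty_subset _) finite_empty (by rw [sUnion_empty, hemp])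
  have henum : ∀ n, ∃ u : ℕ → Set X, (∀ k, u k ∈ 𝒰 n) ∧ ∀ x, ∃ k, x ∈ u k := by
    intro n
    obtain ⟨T, hTc, hTsub, hT⟩ := TopologicalSpace.isOpen_sUnion_countable (𝒰 n) (h𝒰 n).1
    rw [(h𝒰 n).2] at hT
    have hTne : T.Nonempty := nonempty_iff_ne_empty.2 fun hemp => by
      rw [hemp, sUnion_empty] at hT
      exact hXne.ne_empty hT.symm
    obtain ⟨u, rfl⟩ := hTc.exists_eq_range hTne
    refine ⟨u, fun k => hTsub (mem_range_self k), fun x => ?_⟩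
    obtain ⟨_, ⟨k, rfl⟩, hk⟩ := hT.symm ▸ mem_univ x
    exact ⟨k, hk⟩
  choose u hu hucov using henum
  let W : ℕ → ℕ → Set X := fun n k => ⋃₀ (u n '' Iic k)
  have hW_mono : ∀ n, Monotone (W n) := fun n i j hij =>
    sUnion_subset_sUnion (image_mono (Iic_subset_Iic.2 hij))
  have hW_cov : ∀ n x, ∃ k, x ∈ W n k := fun n x =>
    let ⟨k, hk⟩ := hucov n x
    ⟨k, u n k, ⟨k, mem_Iic.2 le_rfl, rfl⟩, hk⟩
  have hW_open : ∀ n k, IsOpen (W n k) := by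
    refine fun n k => isOpen_sUnion ?_
    rintro _ ⟨i, -, rfl⟩
    exact (h𝒰 n).1 _ (hu n i)
  have hW_sub : ∀ n k, u n '' Iic k ⊆ 𝒰 n := by
    rintro n k _ ⟨i, -, rfl⟩
    exact hu n i
  let W' : ℕ → ℕ → Set X := fun n k => W n₀ k ∩ ⋂ i ∈ Finset.range (n + 1), W i k
  have hW'_sub : ∀ {i n : ℕ}, i ≤ n → ∀ k, W' n k ⊆ W i k := fun hin k x hx =>
    mem_iInter₂.1 hx.2 _ (Finset.mem_range.2 (Nat.lt_succ_of_le hin))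
  have hW'_gamma : ∀ n, IsGammaCover (range (W' n)) := by
    refine fun n => isGammaCover_range_s11 ?_ ?_ ?_
    · exact fun i j hij =>
        inter_subset_inter (hW_mono _ hij) (iInter₂_mono fun m _ => hW_mono m hij)
    · intro x
      choose k hk using fun m => hW_cov m x
      refine ⟨max (k n₀) ((Finset.range (n + 1)).sup k),
        hW_mono _ (le_max_left _ _) (hk n₀), mem_iInter₂.2 fun m hm => ?_⟩
      exact hW_mono _ (le_max_of_le_right (Finset.le_sup hm)) (hk m)
    · intro k hk
      refine hn₀ _ (hW_sub n₀ k) ((finite_Iic k).image _) (univ_subset_iff.1 ?_)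
      exact hk ▸ inter_subset_left
  obtain ⟨𝒱, h𝒱, -, -, P, hP, hPU, hPdisj, hPF⟩ := h (fun n => range (W' n)) fun n => by
    refine ⟨?_, hW'_gamma n⟩
    rintro _ ⟨k, rfl⟩
    exact (hW_open n₀ k).inter (isOpen_biInter_finset fun i _ => hW_open i k)
  have hpart : ∀ i, ∃ j, i ≤ j ∧ Disjoint (P j) (⋃ n ∈ Finset.range i, 𝒱 n) := by
    intro i
    have hfin : (⋃ n ∈ Finset.range i, 𝒱 n).Finite :=
      (Finset.range i).finite_toSet.biUnion fun n _ => (h𝒱 n).2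
    by_contra! hcon
    choose! V hV using fun j hj => not_disjoint_iff.1 (hcon j hj)
    obtain ⟨a, ha, b, hb, hab, hVab⟩ := (Ici_infinite i).exists_ne_map_eq_of_mapsTo
      (fun a ha => (hV a ha).2) hfin
    exact disjoint_left.1 (hPdisj a b hab) (hV a ha).1 (hVab ▸ (hV b hb).1)
  choose j hij hj using hpart
  have hbound : ∀ i, ∃ K, ⋃₀ P (j i) ⊆ W i K := by
    intro i
    have hmem : ∀ V ∈ P (j i), ∃ k, V ⊆ W i k := by
      intro V hV
      have hVU : V ∈ ⋃ n, 𝒱 n := hPU ▸ mem_iUnion.2 ⟨j i, hV⟩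
      obtain ⟨n, hn⟩ := mem_iUnion.1 hVU
      have hin : i ≤ n := le_of_not_gt fun hni =>
        disjoint_left.1 (hj i) hV (mem_iUnion₂.2 ⟨n, Finset.mem_range.2 hni, hn⟩)
      obtain ⟨k, rfl⟩ := (h𝒱 n).1 hn
      exact ⟨k, hW'_sub hin k⟩
    choose! k hk using hmem
    obtain ⟨K, hK⟩ := ((hP (j i)).1.image k).bddAbove
    exact ⟨K, sUnion_subset fun V hV =>
      (hk V hV).trans (hW_mono i (hK (mem_image_of_mem k hV)))⟩
  choose K hK using hbound
  refine ⟨fun i => u i '' Iic (K i), fun i => ⟨hW_sub i _, (finite_Iic _).image _⟩, fun y => ?_⟩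
  have htendsto : Tendsto j atTop atTop := tendsto_atTop_mono hij tendsto_id
  filter_upwards [htendsto.eventually (hPF {y} (finite_singleton y))] with i hi
  obtain ⟨U, hU, hyU⟩ := hi
  exact hK i ⟨U, hU, hyU rfl⟩

/-- For separable metrizable spaces, Hurewicz = `S_fin(Γ, Ω^gr)`. -/
theorem hurewicz_iff_Sfin_Gamma_OmegaGr (X : Type*) [TopologicalSpace X]
    [TopologicalSpace.MetrizableSpace X] [TopologicalSpace.SeparableSpace X] :
    Hurewicz X ↔
      ∀ 𝒰 : ℕ → Set (Set X),
        (∀ n, (∀ V ∈ 𝒰 n, IsOpen V) ∧ IsGammaCover (𝒰 n)) →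
        ∃ 𝒱 : ℕ → Set (Set X), (∀ n, 𝒱 n ⊆ 𝒰 n ∧ (𝒱 n).Finite) ∧
          OmegaGroupable (⋃ n, 𝒱 n) := by
  let _ := TopologicalSpace.metrizableSpaceMetric X
  have := UniformSpace.secondCountable_of_separable X
  exact ⟨fun hX => hX.exists_omegaGroupable, hurewicz_of_forall_exists_omegaGroupable⟩
end

section
/- The projectively Hurewicz property is t-invariant: if X and Y are Tychonoff spaces with C_p(X) homeomorphic to C_p(Y), and X is projectively Hurewicz, then Y is projectively Hurewicz. -/
open Set Filter Topology

theorem isCozero_setOf_forall_mem_finset {X ι : Type*} [TopologicalSpace X] {U : ι → Set X}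
    (hU : ∀ i, IsCozero (U i)) (s : Finset ι) : IsCozero {x | ∀ i ∈ s, x ∈ U i} := by
  choose f hf hfU using hU
  refine ⟨fun x => ∏ i ∈ s, f i x, continuous_finsetProd s fun i _ => hf i, ?_⟩
  ext x
  simp [hfU, Finset.prod_eq_zero_iff]

theorem isCozero_setOf_abs_sub_lt {X : Type*} [TopologicalSpace X] {f g : X → ℝ}
    (hf : Continuous f) (hg : Continuous g) (δ : ℝ) : IsCozero {x | |f x - g x| < δ} := by
  refine ⟨fun x => max 0 (δ - |f x - g x|), by fun_prop, ?_⟩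
  ext x
  simp

/-- In a projectively Hurewicz space, any sequence of countable cozero covers admits a choice of
initial segments such that each point is covered by almost all of them. -/
theorem ProjHurewicz.exists_bound {X : Type*} [TopologicalSpace X] (hX : ProjHurewicz X)
    {W : ℕ → ℕ → Set X} (hW : ∀ n k, IsCozero (W n k)) (hcov : ∀ n x, ∃ k, x ∈ W n k) :
    ∃ h : ℕ → ℕ, ∀ x, ∀ᶠ n in atTop, ∃ k < h n, x ∈ W n k := by
  choose f hf hfW using hW
  let φ : X → ℕ × ℕ → ℝ := fun x p => f p.1 p.2 x
  have hφ : Continuous φ := continuous_pi fun p => hf p.1 p.2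
  have hR : Hurewicz (range φ) :=
    hX (range φ) inferInstance inferInstance (rangeFactorization φ)
      (hφ.subtype_mk _) rangeFactorization_surjective
  let V : ℕ → ℕ → Set (range φ) := fun n k => {z | z.1 (n, k) ≠ 0}
  have hVo : ∀ n k, IsOpen (V n k) := fun n k =>
    isOpen_ne_fun ((continuous_apply (n, k)).comp continuous_subtype_val) continuous_const
  obtain ⟨𝒱, h𝒱, hev⟩ := hR (fun n => range (V n)) (fun n => by
    refine ⟨by rintro _ ⟨k, rfl⟩; exact hVo n k, eq_univ_of_forall ?_⟩
    rintro ⟨_, x, rfl⟩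
    obtain ⟨k, hk⟩ := hcov n x
    rw [hfW] at hk
    exact ⟨V n k, ⟨k, rfl⟩, hk⟩)
  have key : ∀ n, ∃ b : ℕ, ∀ A ∈ 𝒱 n, ∃ k < b, V n k = A := by
    intro n
    choose! idx hidx using fun A (hA : A ∈ 𝒱 n) => (h𝒱 n).1 hA
    obtain ⟨b, hb⟩ := ((h𝒱 n).2.image idx).bddAbove
    exact ⟨b + 1, fun A hA =>
      ⟨idx A, Nat.lt_succ_of_le (hb (mem_image_of_mem idx hA)), hidx A hA⟩⟩
  choose h hh using key
  refine ⟨h, fun x => ?_⟩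
  filter_upwards [hev ⟨φ x, mem_range_self x⟩] with n hn
  obtain ⟨A, hA, hxA⟩ := hn
  obtain ⟨k, hk, rfl⟩ := hh n A hA
  refine ⟨k, hk, ?_⟩
  rw [hfW]
  exact hxA

theorem ProjHurewicz.exists_bound₂ {X : Type*} [TopologicalSpace X] (hX : ProjHurewicz X)
    {W : ℕ → ℕ → ℕ → Set X} (hW : ∀ n m k, IsCozero (W n m k))
    (hcov : ∀ n m x, ∃ k, x ∈ W n m k) :
    ∃ h : ℕ → ℕ → ℕ, ∀ x, ∀ᶠ n in atTop, ∀ m, ∃ k < h n m, x ∈ W n m k := by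
  obtain ⟨h, hh⟩ := hX.exists_bound (W := fun p => W p.unpair.1 p.unpair.2)
    (fun p => hW _ _) (fun p => hcov _ _)
  refine ⟨fun n m => h (Nat.pair n m), fun x => ?_⟩
  obtain ⟨N, hN⟩ := eventually_atTop.1 (hh x)
  filter_upwards [eventually_ge_atTop N] with n hn m
  simpa using hN (Nat.pair n m) (hn.trans (Nat.left_le_pair n m))

/-- Each of the segments `[m, H n m)` contains an index `k` with `F ⊆ U n k`, for almost all `n`. -/
def SegmentsCapture {X : Type*} (U : ℕ → ℕ → Set X) (H : ℕ → ℕ → ℕ) (F : Set X) : Prop :=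
  ∀ᶠ n in atTop, ∀ m, ∃ k, m ≤ k ∧ k < H n m ∧ F ⊆ U n k

/-- Segments can be lengthened so that they capture one more point. -/
theorem ProjHurewicz.exists_segmentsCapture_insert {X : Type*} [TopologicalSpace X]
    (hX : ProjHurewicz X) {U : ℕ → ℕ → Set X} (hU : ∀ n k, IsCozero (U n k))
    (hγ : ∀ n x, ∀ᶠ k in atTop, x ∈ U n k) {H : ℕ → ℕ → ℕ} (hH : ∀ n m, m < H n m) :
    ∃ H' : ℕ → ℕ → ℕ, (∀ n m, H n m ≤ H' n m) ∧
      ∀ F x, SegmentsCapture U H F → SegmentsCapture U H' (insert x F) := by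
  have hmono : ∀ n m, StrictMono fun i => (H n)^[i] m := fun n m =>
    strictMono_nat_of_lt_succ fun i => by
      rw [Function.iterate_succ_apply']
      exact hH n _
  obtain ⟨N, hN⟩ := hX.exists_bound₂
    (W := fun n m i => {x | ∀ k ∈ Finset.Ico ((H n)^[i] m) ((H n)^[i + 1] m), x ∈ U n k})
    (fun n m i => isCozero_setOf_forall_mem_finset (hU n) _)
    (fun n m x => by
      obtain ⟨K, hK⟩ := eventually_atTop.1 (hγ n x)
      refine ⟨K, fun k hk => hK k ?_⟩
      exact ((hmono n m).le_apply).trans (Finset.mem_Ico.1 hk).1)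
  refine ⟨fun n m => (H n)^[N n m + 1] m, fun n m => ?_, fun F x hF => ?_⟩
  · exact (hmono n m).monotone (Nat.le_add_left 1 (N n m))
  · filter_upwards [hF, hN x] with n hFn hxn m
    obtain ⟨i, hi, hxi⟩ := hxn m
    obtain ⟨k, hk₁, hk₂, hFk⟩ := hFn ((H n)^[i] m)
    rw [← Function.iterate_succ_apply' (H n)] at hk₂
    refine ⟨k, ((hmono n m).monotone (Nat.zero_le i)).trans hk₁,
      hk₂.trans_le ((hmono n m).monotone (by omega)), insert_subset ?_ hFk⟩
    exact hxi k (Finset.mem_Ico.2 ⟨hk₁, hk₂⟩)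

/-- In a projectively Hurewicz space, a sequence of cozero γ-covers admits finite initial segments
such that each finite set is contained in a member of almost all of them. -/
theorem ProjHurewicz.exists_bound_finite_subset {X : Type*} [TopologicalSpace X]
    (hX : ProjHurewicz X) {U : ℕ → ℕ → Set X} (hU : ∀ n k, IsCozero (U n k))
    (hγ : ∀ n x, ∀ᶠ k in atTop, x ∈ U n k) :
    ∃ h : ℕ → ℕ, ∀ F : Set X, F.Finite → ∀ᶠ n in atTop, ∃ k < h n, F ⊆ U n k := by
  choose step hle hstep using fun H : {H : ℕ → ℕ → ℕ // ∀ n m, m < H n m} =>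
    hX.exists_segmentsCapture_insert hU hγ H.2
  let G : ℕ → {H : ℕ → ℕ → ℕ // ∀ n m, m < H n m} := fun j =>
    Nat.rec ⟨fun _ m => m + 1, fun _ m => Nat.lt_succ_self m⟩
      (fun _ H => ⟨step H, fun n m => (H.2 n m).trans_le (hle H n m)⟩) j
  have hGmono : ∀ n m, Monotone fun j => (G j).1 n m := fun n m =>
    monotone_nat_of_le_succ fun j => hle (G j) n m
  have hcap : ∀ F : Set X, F.Finite → ∃ j, SegmentsCapture U (G j).1 F := by
    intro F hF
    induction F, hF using Set.Finite.induction_on with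
    | empty =>
      exact ⟨0, Eventually.of_forall fun n m =>
        ⟨m, le_rfl, Nat.lt_succ_self m, empty_subset _⟩⟩
    | insert _ _ ih =>
      obtain ⟨j, hj⟩ := ih
      exact ⟨j + 1, hstep (G j) _ _ hj⟩
  refine ⟨fun n => (G n).1 n 0, fun F hF => ?_⟩
  obtain ⟨j, hj⟩ := hcap F hF
  filter_upwards [hj, eventually_ge_atTop j] with n hn hjn
  obtain ⟨k, -, hk, hFk⟩ := hn 0
  exact ⟨k, hk.trans_le (hGmono n 0 hjn), hFk⟩

/-- If `X` is projectively Hurewicz, then from countably many sequences converging to `g` in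
`C_p(X)` one can choose finite initial segments such that each neighbourhood of `g` meets almost
all of them. -/
theorem ProjHurewicz.exists_bound_nhds {X : Type*} [TopologicalSpace X] (hX : ProjHurewicz X)
    {u : ℕ → ℕ → Cp X} {g : Cp X} (hu : ∀ n, Tendsto (u n) atTop (𝓝 g)) :
    ∃ h : ℕ → ℕ, ∀ W ∈ 𝓝 g, ∀ᶠ n in atTop, ∃ k < h n, u n k ∈ W := by
  obtain ⟨h, hh⟩ := hX.exists_bound_finite_subset
    (U := fun n k => {x | |(u n k).1 x - g.1 x| < 1 / ((n : ℝ) + 1)})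
    (fun n k => isCozero_setOf_abs_sub_lt (u n k).2 g.2 _)
    (fun n x => by
      have hx : Tendsto (fun k => (u n k).1 x) atTop (𝓝 (g.1 x)) :=
        tendsto_pi_nhds.1 ((continuous_subtype_val.tendsto g).comp (hu n)) x
      exact hx.eventually (Metric.ball_mem_nhds _ Nat.one_div_pos_of_nat))
  refine ⟨h, fun W hW => ?_⟩
  rw [nhds_subtype_eq_comap, mem_comap] at hW
  obtain ⟨T, hT, hTW⟩ := hW
  rw [nhds_pi, Filter.mem_pi] at hT
  obtain ⟨I, hI, t, ht, hIT⟩ := hT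
  have hball : ∀ᶠ n : ℕ in atTop, ∀ x ∈ I, Metric.ball (g.1 x) (1 / ((n : ℝ) + 1)) ⊆ t x := by
    refine (eventually_all_finite hI).2 fun x _ => ?_
    obtain ⟨ε, hε, hεt⟩ := Metric.mem_nhds_iff.1 (ht x)
    filter_upwards [tendsto_one_div_add_atTop_nhds_zero_nat.eventually (gt_mem_nhds hε)] with n hn
    exact (Metric.ball_subset_ball hn.le).trans hεt
  filter_upwards [hball, hh I hI] with n hn ⟨k, hk, hIk⟩
  exact ⟨k, hk, hTW (hIT fun x hx => hn x hx (hIk hx))⟩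

/-- For an increasing open cover of a metrizable space, the complements of its members carry
continuous functions equal to `1` there and converging to `0` pointwise. -/
theorem exists_continuous_tendsto_zero_of_monotone_cover {Z : Type*} [TopologicalSpace Z]
    [TopologicalSpace.MetrizableSpace Z] {W : ℕ → Set Z} (hW : ∀ k, IsOpen (W k))
    (hmono : Monotone W) (hcov : ∀ z, ∃ k, z ∈ W k) :
    ∃ f : ℕ → Z → ℝ, (∀ k, Continuous (f k)) ∧ (∀ k, ∀ z ∉ W k, f k z = 1) ∧
      ∀ z, Tendsto (fun k => f k z) atTop (𝓝 0) := by
  let _ := TopologicalSpace.metrizableSpaceMetric Z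
  have hδ : ∀ k : ℕ, (0 : ℝ) < 1 / ((k : ℝ) + 1) := fun _ => Nat.one_div_pos_of_nat
  refine ⟨fun k z => thickenedIndicator (hδ k) (W k)ᶜ z, fun k => by fun_prop,
    fun k z hz => ?_, fun z => ?_⟩
  · simp only [thickenedIndicator_one (hδ k) (W k)ᶜ hz, NNReal.coe_one]
  · obtain ⟨k₀, hk₀⟩ := hcov z
    obtain ⟨ε, hε, hεW⟩ := Metric.isOpen_iff.1 (hW k₀) z hk₀
    refine tendsto_const_nhds.congr' ?_
    filter_upwards [tendsto_one_div_add_atTop_nhds_zero_nat.eventually (gt_mem_nhds hε),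
      eventually_ge_atTop k₀] with k hk hkk
    have hz : z ∉ Metric.thickening (1 / ((k : ℝ) + 1)) (W k)ᶜ := by
      rw [Metric.mem_thickening_iff]
      rintro ⟨w, hw, hzw⟩
      exact hw (hmono hkk (hεW (by rw [Metric.mem_ball, dist_comm]; exact hzw.trans hk)))
    simp only [thickenedIndicator_zero (hδ k) (W k)ᶜ hz, NNReal.coe_zero]

/-- the projectively Hurewicz property is `t`-invariant. -/
theorem projHurewicz_t_invariant (X Y : Type*) [TopologicalSpace X] [TopologicalSpace Y]
    [T35Space X] [T35Space Y] (e : Cp X ≃ₜ Cp Y) (hX : ProjHurewicz X) :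
    ProjHurewicz Y := by
  intro Z _ hZm hZs f hf hfs 𝒰 h𝒰
  rcases isEmpty_or_nonempty Z with hZ | hZ
  · exact ⟨fun _ => ∅, fun _ => ⟨empty_subset _, finite_empty⟩, fun z => hZ.elim z⟩
  have hZ₂ : SecondCountableTopology Z := by
    let _ := TopologicalSpace.metrizableSpaceMetric Z
    exact UniformSpace.secondCountable_of_separable Z
  have hsub : ∀ n, ∃ V : ℕ → Set Z, (∀ k, V k ∈ 𝒰 n) ∧ ∀ z, ∃ k, z ∈ V k := by
    intro n
    obtain ⟨T, hTc, hTU, hT⟩ := TopologicalSpace.isOpen_sUnion_countable (𝒰 n) (h𝒰 n).1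
    rw [(h𝒰 n).2] at hT
    have hTne : T.Nonempty := by
      obtain ⟨A, hA, -⟩ := (hT ▸ mem_univ (Classical.arbitrary Z) : _ ∈ ⋃₀ T)
      exact ⟨A, hA⟩
    obtain ⟨V, rfl⟩ := hTc.exists_eq_range hTne
    refine ⟨V, fun k => hTU (mem_range_self k), fun z => ?_⟩
    have hz : z ∈ ⋃₀ range V := hT ▸ mem_univ z
    simpa using hz
  choose V hVU hVcov using hsub
  choose φ hφc hφ₁ hφ₀ using fun n => exists_continuous_tendsto_zero_of_monotone_cover
    (W := fun k => ⋃ j ≤ k, V n j)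
    (fun k => isOpen_biUnion fun j _ => (h𝒰 n).1 _ (hVU n j))
    (fun a b hab => biUnion_subset_biUnion_left fun j hj => le_trans hj hab)
    (fun z => (hVcov n z).imp fun k hk => mem_biUnion (le_refl k) hk)
  let v : ℕ → ℕ → Cp Y := fun n k => ⟨φ n k ∘ f, (hφc n k).comp hf⟩
  have hv : ∀ n, Tendsto (v n) atTop (𝓝 (zeroCp Y)) := fun n =>
    tendsto_subtype_rng.2 (tendsto_pi_nhds.2 fun y => hφ₀ n (f y))
  obtain ⟨h, hh⟩ := hX.exists_bound_nhds (u := fun n k => e.symm (v n k))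
    fun n => (e.symm.continuous.tendsto _).comp (hv n)
  refine ⟨fun n => V n '' Iio (h n), fun n => ⟨?_, (finite_Iio _).image _⟩, fun z => ?_⟩
  · rintro _ ⟨k, -, rfl⟩
    exact hVU n k
  obtain ⟨y, rfl⟩ := hfs z
  have hO : {w : Cp Y | w.1 y < 1} ∈ 𝓝 (e (e.symm (zeroCp Y))) := by
    rw [e.apply_symm_apply]
    refine (isOpen_lt ((continuous_apply y).comp continuous_subtype_val)
      continuous_const).mem_nhds ?_
    simp [zeroCp]
  filter_upwards [hh _ (e.continuous.continuousAt.preimage_mem_nhds hO)] with n ⟨k, hk, hkn⟩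
  have hlt : φ n k (f y) < 1 := by simpa [v] using hkn
  by_contra hny
  refine hlt.ne (hφ₁ n k (f y) fun hmem => hny ?_)
  obtain ⟨j, hj, hjy⟩ := mem_iUnion₂.1 hmem
  exact ⟨V n j, ⟨j, lt_of_le_of_lt hj hk, rfl⟩, hjy⟩
end
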